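/- Let B = (A, R) be a blueprint. Every maximal ideal of B is a prime ideal. If moreover B is with a zero, then every maximal congruence on B is a prime congruence. -/

import Mathlib

/-! Congruences on a blueprint `B = (A, R)`, where `R` is a pre-addition, i.e. a semiring
congruence (`RingCon`) on the monoid semiring `ℕ[A] = MonoidAlgebra ℕ A`. -/

/-- `x` and `y` are termwise related sums: `x = Σ aᵢ`, `y = Σ bᵢ` with `r aᵢ bᵢ` for all `i`. -/
def Blueprint.Termwise {A : Type*} [CommMonoid A] (r : A → A → Prop)
    (x y : MonoidAlgebra ℕ A) : Prop :=
  ∃ l : List (A × A), (∀ p ∈ l, r p.1 p.2) ∧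
    x = (l.map fun p => MonoidAlgebra.of ℕ A p.1).sum ∧
    y = (l.map fun p => MonoidAlgebra.of ℕ A p.2).sum

/-- The linear extension `∼_ℕ` of a relation `∼` on `A` to `ℕ[A]`: the smallest equivalence
relation such that `Σ aᵢ ∼_ℕ Σ bᵢ` whenever `aᵢ ∼ bᵢ` termwise. -/
def Blueprint.LinExt {A : Type*} [CommMonoid A] (r : A → A → Prop) :
    MonoidAlgebra ℕ A → MonoidAlgebra ℕ A → Prop :=
  Relation.EqvGen (Blueprint.Termwise r)

/-- `∼_R`: the smallest equivalence relation on `ℕ[A]` containing both `R` and `∼_ℕ`. -/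
def Blueprint.SimR {A : Type*} [CommMonoid A] (R : RingCon (MonoidAlgebra ℕ A))
    (r : A → A → Prop) : MonoidAlgebra ℕ A → MonoidAlgebra ℕ A → Prop :=
  Relation.EqvGen (fun x y => R x y ∨ Blueprint.LinExt r x y)

/-- A congruence on the blueprint `(A, R)`: an equivalence relation `∼` on `A` such that
(C1) `∼_ℕ` is a pre-addition (additive and multiplicative) and (C2) the restriction of
`∼_R` to `A` equals `∼`. -/
structure Blueprint.IsCongruence {A : Type*} [CommMonoid A]
    (R : RingCon (MonoidAlgebra ℕ A)) (r : A → A → Prop) : Prop where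
  equiv : Equivalence r
  lin_add : ∀ x x' y y' : MonoidAlgebra ℕ A, Blueprint.LinExt r x x' →
    Blueprint.LinExt r y y' → Blueprint.LinExt r (x + y) (x' + y')
  lin_mul : ∀ x x' y y' : MonoidAlgebra ℕ A, Blueprint.LinExt r x x' →
    Blueprint.LinExt r y y' → Blueprint.LinExt r (x * y) (x' * y')
  restrict : ∀ a b : A,
    Blueprint.SimR R r (MonoidAlgebra.of ℕ A a) (MonoidAlgebra.of ℕ A b) ↔ r a b

/-- A finite chain `x ≡ Σc₁ ∼_ℕ Σd₁ ≡ Σc₂ ∼_ℕ ⋯ ∼_ℕ Σdₙ ≡ y` alternating between the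
pre-addition `R` and the linear extension `∼_ℕ` of `∼`. -/
def Blueprint.ChainRel {A : Type*} [CommMonoid A] (R : RingCon (MonoidAlgebra ℕ A))
    (r : A → A → Prop) (x y : MonoidAlgebra ℕ A) : Prop :=
  ∃ z : MonoidAlgebra ℕ A, R x z ∧
    Relation.ReflTransGen (fun u v => ∃ w, Blueprint.LinExt r u w ∧ R w v) z y

/-- The equivalence relation `∼^I` on `A` associated to a subset `I ⊆ A`:
`a ∼^I b` iff `a = b` or `a, b ∈ I`. -/
def Blueprint.relOfSet {A : Type*} (I : Set A) : A → A → Prop :=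
  fun a b => a = b ∨ (a ∈ I ∧ b ∈ I)

/-- The relation `∼_I` on `A`: the restriction to `A` of the smallest equivalence relation
on `ℕ[A]` containing `R` and the linear extension of `∼^I`. -/
def Blueprint.SimI {A : Type*} [CommMonoid A] (R : RingCon (MonoidAlgebra ℕ A))
    (I : Set A) : A → A → Prop :=
  fun a b => Blueprint.SimR R (Blueprint.relOfSet I)
    (MonoidAlgebra.of ℕ A a) (MonoidAlgebra.of ℕ A b)

/-- An ideal of the blueprint `B = (A, R)`. -/
structure Blueprint.IsIdeal {A : Type*} [CommMonoid A]
    (R : RingCon (MonoidAlgebra ℕ A)) (I : Set A) : Prop where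
  mul_mem : ∀ a ∈ I, ∀ b : A, a * b ∈ I
  zero_mem : ∀ e : A, R (MonoidAlgebra.of ℕ A e) 0 → e ∈ I
  closed : ∀ a b : A, Blueprint.SimI R I a b → b ∈ I → a ∈ I

/-- A prime ideal: an ideal whose complement is a multiplicative subset containing `1`. -/
structure Blueprint.IsPrimeIdeal {A : Type*} [CommMonoid A]
    (R : RingCon (MonoidAlgebra ℕ A)) (I : Set A) : Prop where
  isIdeal : Blueprint.IsIdeal R I
  one_not_mem : (1 : A) ∉ I
  mul_not_mem : ∀ a b : A, a ∉ I → b ∉ I → a * b ∉ I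

/-- A prime congruence: a proper congruence (one with more than one equivalence class)
such that `ab ∼ ac` implies `b ∼ c` or `a ∼ e` for some zero `e ≡ 0`. -/
structure Blueprint.IsPrimeCongruence {A : Type*} [CommMonoid A]
    (R : RingCon (MonoidAlgebra ℕ A)) (r : A → A → Prop) : Prop where
  isCongruence : Blueprint.IsCongruence R r
  proper : ∃ a b : A, ¬ r a b
  prime : ∀ a b c : A, r (a * b) (a * c) →
    r b c ∨ ∃ e : A, R (MonoidAlgebra.of ℕ A e) 0 ∧ r a e

/-- `B` is *with a zero*. -/
def Blueprint.HasZeroElem {A : Type*} [CommMonoid A] (R : RingCon (MonoidAlgebra ℕ A)) : Prop :=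
  ∃ e : A, R (MonoidAlgebra.of ℕ A e) 0

namespace Blueprint

theorem relOfSet_refl {A : Type*} (S : Set A) (a : A) : relOfSet S a a := .inl rfl

section

variable {A : Type*} [CommMonoid A] {R : RingCon (MonoidAlgebra ℕ A)} {r s : A → A → Prop}

theorem Termwise.of_rel {a b : A} (h : r a b) :
    Termwise r (MonoidAlgebra.of ℕ A a) (MonoidAlgebra.of ℕ A b) :=
  ⟨[(a, b)], by simpa using h, by simp, by simp⟩

theorem Termwise.add {x x' y y' : MonoidAlgebra ℕ A} (h : Termwise r x x')
    (h' : Termwise r y y') : Termwise r (x + y) (x' + y') := by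
  obtain ⟨l, hl, rfl, rfl⟩ := h
  obtain ⟨l', hl', rfl, rfl⟩ := h'
  refine ⟨l ++ l', fun p hp => ?_, by simp, by simp⟩
  exact (List.mem_append.1 hp).elim (hl p) (hl' p)

theorem Termwise.refl (hr : ∀ a, r a a) (x : MonoidAlgebra ℕ A) : Termwise r x x := by
  induction x using MonoidAlgebra.induction_on with
  | of a => exact .of_rel (hr a)
  | add x y hx hy => exact hx.add hy
  | smul n x hx =>
    induction n with
    | zero => exact ⟨[], by simp, by simp, by simp⟩
    | succ n ih => simpa only [add_smul, one_smul] using ih.add hx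

theorem LinExt.of_rel {a b : A} (h : r a b) :
    LinExt r (MonoidAlgebra.of ℕ A a) (MonoidAlgebra.of ℕ A b) :=
  .rel _ _ (.of_rel h)

theorem LinExt.add_right (hr : ∀ a, r a a) {x x' : MonoidAlgebra ℕ A} (h : LinExt r x x')
    (y : MonoidAlgebra ℕ A) : LinExt r (x + y) (x' + y) := by
  induction h with
  | rel _ _ h => exact .rel _ _ (h.add (.refl hr y))
  | refl => exact .refl _
  | symm _ _ _ ih => exact ih.symm
  | trans _ _ _ _ _ ih ih' => exact ih.trans _ _ _ ih'

theorem LinExt.add (hr : ∀ a, r a a) {x x' y y' : MonoidAlgebra ℕ A} (h : LinExt r x x')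
    (h' : LinExt r y y') : LinExt r (x + y) (x' + y') :=
  (h.add_right hr y).trans _ _ _ (add_comm y x' ▸ add_comm y' x' ▸ h'.add_right hr x')

theorem SimR.of_con {x y : MonoidAlgebra ℕ A} (h : R x y) : SimR R r x y :=
  .rel _ _ (.inl h)

theorem SimR.of_rel {a b : A} (h : r a b) :
    SimR R r (MonoidAlgebra.of ℕ A a) (MonoidAlgebra.of ℕ A b) :=
  .rel _ _ (.inr (.of_rel h))

theorem SimR.add_right (hr : ∀ a, r a a) {x x' : MonoidAlgebra ℕ A} (h : SimR R r x x')
    (y : MonoidAlgebra ℕ A) : SimR R r (x + y) (x' + y) := by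
  induction h with
  | rel _ _ h =>
    exact .rel _ _ (h.imp (fun h => R.add h (R.refl y)) (fun h => h.add_right hr y))
  | refl => exact .refl _
  | symm _ _ _ ih => exact ih.symm
  | trans _ _ _ _ _ ih ih' => exact ih.trans _ _ _ ih'

theorem SimR.add (hr : ∀ a, r a a) {x x' y y' : MonoidAlgebra ℕ A} (h : SimR R r x x')
    (h' : SimR R r y y') : SimR R r (x + y) (x' + y') :=
  (h.add_right hr y).trans _ _ _ (add_comm y x' ▸ add_comm y' x' ▸ h'.add_right hr x')

/-- If multiplication by `b` carries `r` into `∼_R` for `s`, then it carries all of `∼_R` for `r`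
into `∼_R` for `s`. -/
theorem SimR.of_mul (hs : ∀ a, s a a) (b : A)
    (hrs : ∀ a a', r a a' →
      SimR R s (MonoidAlgebra.of ℕ A (b * a)) (MonoidAlgebra.of ℕ A (b * a')))
    {x y : MonoidAlgebra ℕ A} (h : SimR R r x y) :
    SimR R s (MonoidAlgebra.of ℕ A b * x) (MonoidAlgebra.of ℕ A b * y) := by
  induction h with
  | rel _ _ h =>
    rcases h with h | h
    · exact .of_con (R.mul (R.refl _) h)
    · induction h with
      | rel _ _ h =>
        obtain ⟨l, hl, rfl, rfl⟩ := h
        induction l with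
        | nil => exact .refl _
        | cons p l ih =>
          simp only [List.map_cons, List.sum_cons, mul_add, ← map_mul]
          exact .add hs (hrs _ _ (hl p (by simp))) (ih fun q hq => hl q (by simp [hq]))
      | refl => exact .refl _
      | symm _ _ _ ih => exact ih.symm
      | trans _ _ _ _ _ ih ih' => exact ih.trans _ _ _ ih'
  | refl => exact .refl _
  | symm _ _ _ ih => exact ih.symm
  | trans _ _ _ _ _ ih ih' => exact ih.trans _ _ _ ih'

theorem SimR.of_le (hs : ∀ a, s a a)
    (hrs : ∀ a a', r a a' → SimR R s (MonoidAlgebra.of ℕ A a) (MonoidAlgebra.of ℕ A a'))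
    {x y : MonoidAlgebra ℕ A} (h : SimR R r x y) : SimR R s x y := by
  have := SimR.of_mul hs 1 (by simpa only [one_mul] using hrs) h
  rwa [map_one, one_mul, one_mul] at this

theorem LinExt.of_mul_left (hr : ∀ a, r a a) (b : A) (hb : ∀ a a', r a a' → r (b * a) (b * a'))
    {x y : MonoidAlgebra ℕ A} (h : LinExt r x y) :
    LinExt r (MonoidAlgebra.of ℕ A b * x) (MonoidAlgebra.of ℕ A b * y) := by
  induction h with
  | rel _ _ h =>
    obtain ⟨l, hl, rfl, rfl⟩ := h
    induction l with
    | nil => exact .refl _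
    | cons p l ih =>
      simp only [List.map_cons, List.sum_cons, mul_add, ← map_mul]
      exact .add hr (.of_rel (hb _ _ (hl p (by simp)))) (ih fun q hq => hl q (by simp [hq]))
  | refl => exact .refl _
  | symm _ _ _ ih => exact ih.symm
  | trans _ _ _ _ _ ih ih' => exact ih.trans _ _ _ ih'

theorem LinExt.mul_left (hr : ∀ a, r a a) (hm : ∀ b a a', r a a' → r (b * a) (b * a'))
    (z : MonoidAlgebra ℕ A) {x y : MonoidAlgebra ℕ A} (h : LinExt r x y) :
    LinExt r (z * x) (z * y) := by
  induction z using MonoidAlgebra.induction_on with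
  | of b => exact h.of_mul_left hr b (hm b)
  | add z z' hz hz' => simpa only [add_mul] using hz.add hr hz'
  | smul n z hz =>
    induction n with
    | zero =>
      simp only [zero_smul, zero_mul]
      exact .refl _
    | succ n ih => simpa only [add_smul, one_smul, add_mul] using ih.add hr hz

theorem LinExt.mul (hr : ∀ a, r a a) (hm : ∀ b a a', r a a' → r (b * a) (b * a'))
    {x x' y y' : MonoidAlgebra ℕ A} (h : LinExt r x x') (h' : LinExt r y y') :
    LinExt r (x * y) (x' * y') :=
  (show LinExt r (x * y) (x' * y) by
    simpa only [mul_comm _ y] using h.mul_left hr hm y).trans _ _ _ (h'.mul_left hr hm x')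

theorem IsCongruence.mul_left (h : IsCongruence R r) (b : A) {a a' : A} (ha : r a a') :
    r (b * a) (b * a') := by
  refine (h.restrict _ _).1 (.rel _ _ (.inr ?_))
  simpa only [map_mul] using h.lin_mul _ _ _ _ (.refl (MonoidAlgebra.of ℕ A b)) (.of_rel ha)

/-- The congruence quotient of `r` by `a`, relating `b` and `c` whenever `ab ∼ ac`. -/
theorem IsCongruence.comap_mul_left (h : IsCongruence R r) (a : A) :
    IsCongruence R fun b c => r (a * b) (a * c) where
  equiv := ⟨fun _ => h.equiv.refl _, h.equiv.symm, h.equiv.trans⟩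
  lin_add _ _ _ _ hx hy :=
    LinExt.add (r := fun b c => r (a * b) (a * c)) (fun _ => h.equiv.refl _) hx hy
  lin_mul _ _ _ _ hx hy := LinExt.mul (r := fun b c => r (a * b) (a * c)) (fun _ => h.equiv.refl _)
    (fun b c c' hc => by simpa only [mul_left_comm a b] using h.mul_left b hc) hx hy
  restrict b c := by
    refine ⟨fun hbc => (h.restrict _ _).1 ?_, fun hbc => .of_rel hbc⟩
    rw [map_mul, map_mul]
    exact hbc.of_mul h.equiv.refl a fun _ _ h' => .of_rel h'

theorem con_of_mul_zero {e : A} (he : R (MonoidAlgebra.of ℕ A e) 0) (a : A) :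
    R (MonoidAlgebra.of ℕ A (a * e)) (MonoidAlgebra.of ℕ A e) := by
  have := R.mul (R.refl (MonoidAlgebra.of ℕ A a)) he
  rw [mul_zero, ← map_mul] at this
  exact R.trans this (R.symm he)

theorem SimI.of_mem {S : Set A} {a b : A} (ha : a ∈ S) (hb : b ∈ S) : SimI R S a b :=
  .of_rel (.inr ⟨ha, hb⟩)

theorem SimI.mul_left {S T : Set A} {b : A} (hb : ∀ x ∈ S, b * x ∈ T) {x y : A}
    (h : SimI R S x y) : SimI R T (b * x) (b * y) := by
  rw [SimI, map_mul, map_mul]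
  refine SimR.of_mul (relOfSet_refl T) b ?_ h
  rintro a a' (rfl | ⟨ha, ha'⟩)
  · exact .refl _
  · exact SimI.of_mem (hb _ ha) (hb _ ha')

/-- The `∼_S`-class of a point of a multiplicatively absorbing subset `S` is an ideal. -/
theorem isIdeal_setOf_simI {S : Set A} (hS : ∀ x ∈ S, ∀ b, b * x ∈ S) {a : A} (ha : a ∈ S) :
    IsIdeal R {x | SimI R S x a} where
  mul_mem x hx b := by
    have := SimI.mul_left (fun y hy => hS y hy b) hx
    rw [Set.mem_ofPred_eq, mul_comm]
    exact this.trans _ _ _ (SimI.of_mem (hS a ha b) ha)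
  zero_mem e he := by
    have h : SimI R S (a * e) e := .of_con (con_of_mul_zero he a)
    exact h.symm.trans _ _ _ (SimI.of_mem (mul_comm e a ▸ hS a ha e) ha)
  closed x y hxy hy := by
    refine (SimR.of_le (relOfSet_refl S) ?_ hxy).trans _ _ _ hy
    rintro b c (rfl | ⟨hb, hc⟩)
    · exact .refl _
    · exact hb.trans _ _ _ hc.symm

end

end Blueprint

/-- Every maximal ideal of a blueprint `B = (A, R)` (a proper ideal not
contained in any strictly larger proper ideal) is a prime ideal. If moreover `B` is with a
zero, then every maximal congruence (a proper congruence not contained in any strictly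
larger proper congruence) is a prime congruence. -/
theorem blueprint_maximal_is_prime {A : Type*} [CommMonoid A]
    (R : RingCon (MonoidAlgebra ℕ A)) :
    (∀ I : Set A, Blueprint.IsIdeal R I → I ≠ Set.univ →
      (∀ J : Set A, Blueprint.IsIdeal R J → J ≠ Set.univ → I ⊆ J → J = I) →
      Blueprint.IsPrimeIdeal R I) ∧
    (Blueprint.HasZeroElem R →
      ∀ r : A → A → Prop, Blueprint.IsCongruence R r → (∃ a b : A, ¬ r a b) →
        (∀ s : A → A → Prop, Blueprint.IsCongruence R s → (∃ a b : A, ¬ s a b) →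
          (∀ a b : A, r a b → s a b) → s = r) →
        Blueprint.IsPrimeCongruence R r) := by
  refine ⟨fun I hI hne hmax => ⟨hI, fun h1 => hne ?_, fun a b ha hb hab => hb ?_⟩, ?_⟩
  · exact Set.eq_univ_of_forall fun x => one_mul x ▸ hI.mul_mem 1 h1 x
  · let S : Set A := I ∪ Set.range (a * ·)
    have haS : a ∈ S := .inr ⟨1, mul_one a⟩
    have hS : ∀ x ∈ S, ∀ c, c * x ∈ S := by
      rintro x (hx | ⟨d, rfl⟩) c
      · exact .inl (mul_comm c x ▸ hI.mul_mem x hx c)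
      · exact .inr ⟨c * d, mul_left_comm a c d⟩
    have huniv : {x | Blueprint.SimI R S x a} = Set.univ := by
      by_contra hJ
      refine ha ?_
      rw [← hmax _ (Blueprint.isIdeal_setOf_simI hS haS) hJ fun x hx => .of_mem (.inl hx) haS]
      exact .refl _
    have h1 : Blueprint.SimI R S 1 a := huniv.ge (Set.mem_univ 1)
    have hbS : ∀ x ∈ S, b * x ∈ I := by
      rintro x (hx | ⟨d, rfl⟩)
      · exact mul_comm b x ▸ hI.mul_mem x hx b
      · simpa only [mul_comm a b, mul_assoc] using hI.mul_mem _ hab d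
    exact hI.closed b _ (by simpa only [mul_one] using h1.mul_left hbS) (hbS a haS)
  · rintro ⟨e, he⟩ r hr hproper hmax
    refine ⟨hr, hproper, fun a b c habc => or_iff_not_imp_right.2 fun ha => ?_⟩
    have hae : r (a * e) e := (hr.restrict _ _).1 (.of_con (Blueprint.con_of_mul_zero he a))
    rw [← hmax _ (hr.comap_mul_left a) ⟨1, e, fun h => ha ⟨e, he, ?_⟩⟩
      fun x y hxy => hr.mul_left a hxy]
    · exact habc
    · exact hr.equiv.trans (by rwa [mul_one] at h) hae
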